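/- Let m ∈ ℕ with m ≥ 1 and α ∈ (0,1]. If g ∈ C^{m+1,α}_b(ℝ^d,ℝ^d), then the left translation g_⋆ : C^{m,α}_b(ℝ^d,ℝ^d) → C^{m,α}_b(ℝ^d,ℝ^d), g_⋆(f) := g∘(Id+f), is locally Lipschitz: every f₀ ∈ C^{m,α}_b(ℝ^d,ℝ^d) has a neighborhood V and a constant C such that ‖g∘(Id+f₁) − g∘(Id+f₂)‖_{m,α} ≤ C ‖f₁−f₂‖_{m,α} for all f₁, f₂ ∈ V. -/

import Mathlib

open Function Set Filter Topology MeasureTheory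
open scoped ENNReal NNReal

noncomputable section

section Defs

variable {E F : Type*} [NormedAddCommGroup E] [NormedSpace ℝ E]
  [NormedAddCommGroup F] [NormedSpace ℝ F]

/-- `‖f‖_n = max_{0 ≤ l ≤ n} sup_x ‖f⁽ˡ⁾(x)‖`, as an extended real. -/
def eCnb (n : ℕ) (f : E → F) : ℝ≥0∞ :=
  ⨆ (l : Fin (n + 1)) (x : E), (‖iteratedFDeriv ℝ (l : ℕ) f x‖₊ : ℝ≥0∞)

/-- The Hölder seminorm `[f]_{n,α}`, as an extended real. -/
def eHsemi (n : ℕ) (α : ℝ) (f : E → F) : ℝ≥0∞ :=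
  ⨆ (x : E) (y : E) (_ : x ≠ y),
    (‖iteratedFDeriv ℝ n f x - iteratedFDeriv ℝ n f y‖₊ : ℝ≥0∞) / edist x y ^ α

/-- The Hölder norm `‖f‖_{n,α} = max(‖f‖_n, [f]_{n,α})`, as an extended real. -/
def eHnorm (n : ℕ) (α : ℝ) (f : E → F) : ℝ≥0∞ := max (eCnb n f) (eHsemi n α f)

/-- The Hölder norm `‖f‖_{n,α}` as a real number (junk value `0` when infinite). -/
def hnorm (n : ℕ) (α : ℝ) (f : E → F) : ℝ := (eHnorm n α f).toReal

/-- Membership in the global Hölder space `C^{n,α}_b(E,F)`. -/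
def MemCb (n : ℕ) (α : ℝ) (f : E → F) : Prop :=
  ContDiff ℝ (n : ℕ∞) f ∧ eHnorm n α f < ⊤

/-- Membership in `C^{n,α}_0(E,F)`: moreover all derivatives up to order `n`
vanish at infinity. -/
def MemC0 (n : ℕ) (α : ℝ) (f : E → F) : Prop :=
  MemCb n α f ∧
    ∀ l ≤ n, Tendsto (fun x => ‖iteratedFDeriv ℝ l f x‖) (cocompact E) (𝓝 0)

end Defs

/-- `ℝ^d` -/
abbrev Euc (d : ℕ) : Type := EuclideanSpace ℝ (Fin d)

/-- Membership in the diffeomorphism group `D^{n,β}(ℝ^d)`: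
`Φ - Id ∈ C^{n,β}_0` and `det dΦ(x) > 0` everywhere. -/
def MemD (d n : ℕ) (β : ℝ) (Φ : Euc d → Euc d) : Prop :=
  MemC0 n β (fun x => Φ x - x) ∧
    ∀ x, 0 < LinearMap.det ((fderiv ℝ Φ x : Euc d →L[ℝ] Euc d) : Euc d →ₗ[ℝ] Euc d)

end

/-- `f` is of class `C^n`, its derivatives up to order `n` are bounded by `K`, and the `n`-th
derivative is `α`-Hölder with constant `K`. -/
structure HolderBound {E F : Type*} [NormedAddCommGroup E] [NormedSpace ℝ E]
    [NormedAddCommGroup F] [NormedSpace ℝ F] (n : ℕ) (α K : ℝ) (f : E → F) : Prop where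
  contDiff : ContDiff ℝ n f
  bound : ∀ l ≤ n, ∀ x, ‖iteratedFDeriv ℝ l f x‖ ≤ K
  holder : ∀ x y, ‖iteratedFDeriv ℝ n f x - iteratedFDeriv ℝ n f y‖ ≤ K * ‖x - y‖ ^ α

section Norm

variable {E F : Type*} [NormedAddCommGroup E] [NormedSpace ℝ E]
  [NormedAddCommGroup F] [NormedSpace ℝ F] {n : ℕ} {α K : ℝ} {f : E → F}

theorem HolderBound.eHnorm_le (h : HolderBound n α K f) : eHnorm n α f ≤ ENNReal.ofReal K := by
  refine max_le (iSup₂_le fun l x => ?_) (iSup₂_le fun x y => iSup_le fun hxy => ?_)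
  · rw [← enorm_eq_nnnorm, ← ofReal_norm]
    exact ENNReal.ofReal_le_ofReal (h.bound l (Nat.lt_succ_iff.mp l.2) x)
  · have hpos : 0 < ‖x - y‖ := norm_pos_iff.mpr (sub_ne_zero.mpr hxy)
    have hK : 0 ≤ K := (norm_nonneg _).trans (h.bound 0 n.zero_le x)
    apply ENNReal.div_le_of_le_mul
    rw [← enorm_eq_nnnorm, ← ofReal_norm, edist_dist, dist_eq_norm,
      ENNReal.ofReal_rpow_of_pos hpos, ← ENNReal.ofReal_mul hK]
    exact ENNReal.ofReal_le_ofReal (h.holder x y)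

theorem HolderBound.hnorm_le [Nonempty E] (h : HolderBound n α K f) : hnorm n α f ≤ K :=
  ENNReal.toReal_le_of_le_ofReal
    ((norm_nonneg _).trans (h.bound 0 n.zero_le (Classical.arbitrary E))) h.eHnorm_le

theorem HolderBound.memCb (h : HolderBound n α K f) : MemCb n α f :=
  ⟨h.contDiff, h.eHnorm_le.trans_lt ENNReal.ofReal_lt_top⟩

theorem MemCb.holderBound (hα : 0 < α) (h : MemCb n α f) :
    HolderBound n α (hnorm n α f) f where
  contDiff := h.1
  bound l hl x := by
    have h1 : (‖iteratedFDeriv ℝ l f x‖₊ : ℝ≥0∞) ≤ eHnorm n α f :=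
      (le_iSup₂ (f := fun (l : Fin (n + 1)) (x : E) =>
        (‖iteratedFDeriv ℝ (l : ℕ) f x‖₊ : ℝ≥0∞)) ⟨l, Nat.lt_succ_of_le hl⟩ x).trans
        (le_max_left _ _)
    simpa [hnorm] using ENNReal.toReal_mono h.2.ne h1
  holder x y := by
    rcases eq_or_ne x y with rfl | hxy
    · simp [Real.zero_rpow hα.ne']
    have hpos : 0 < ‖x - y‖ := norm_pos_iff.mpr (sub_ne_zero.mpr hxy)
    have h1 : (‖iteratedFDeriv ℝ n f x - iteratedFDeriv ℝ n f y‖₊ : ℝ≥0∞) / edist x y ^ α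
        ≤ eHnorm n α f :=
      ((le_iSup_of_le hxy le_rfl).trans (le_iSup₂ (f := fun (x y : E) => ⨆ _ : x ≠ y,
        (‖iteratedFDeriv ℝ n f x - iteratedFDeriv ℝ n f y‖₊ : ℝ≥0∞) / edist x y ^ α) x y)).trans
        (le_max_right _ _)
    have h2 := ENNReal.toReal_mono h.2.ne h1
    rw [ENNReal.toReal_div, ← ENNReal.toReal_rpow, edist_dist, dist_eq_norm,
      ENNReal.toReal_ofReal hpos.le, div_le_iff₀ (Real.rpow_pos_of_pos hpos α)] at h2
    simpa [hnorm] using h2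

end Norm

theorem norm_sub_le_rpow_of_lipschitz {E F : Type*} [NormedAddCommGroup E] [NormedAddCommGroup F]
    {α K : ℝ} {f : E → F} (hα : 0 < α) (hα1 : α ≤ 1) (hb : ∀ x, ‖f x‖ ≤ K)
    (hl : ∀ x y, ‖f x - f y‖ ≤ K * ‖x - y‖) (x y : E) :
    ‖f x - f y‖ ≤ 2 * K * ‖x - y‖ ^ α := by
  have hK : 0 ≤ K := (norm_nonneg _).trans (hb x)
  rcases le_total ‖x - y‖ 1 with h | h
  · have h1 : ‖x - y‖ ≤ ‖x - y‖ ^ α := by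
      simpa using Real.rpow_le_rpow_of_exponent_ge_of_imp (norm_nonneg (x - y)) h hα1
        (fun _ h0 => absurd h0 one_ne_zero)
    have := hl x y
    nlinarith [mul_le_mul_of_nonneg_left h1 hK, norm_nonneg (x - y)]
  · have h1 : 1 ≤ ‖x - y‖ ^ α := Real.one_le_rpow h hα.le
    have := norm_sub_le_of_le (hb x) (hb y)
    nlinarith

namespace HolderBound

universe u

variable {E F G H : Type u} [NormedAddCommGroup E] [NormedSpace ℝ E]
  [NormedAddCommGroup F] [NormedSpace ℝ F] [NormedAddCommGroup G] [NormedSpace ℝ G]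
  [NormedAddCommGroup H] [NormedSpace ℝ H] {n : ℕ} {α K L : ℝ} {f f₁ f₂ : E → F}

theorem mono (h : HolderBound n α K f) (hKL : K ≤ L) : HolderBound n α L f where
  contDiff := h.contDiff
  bound l hl x := (h.bound l hl x).trans hKL
  holder x y := (h.holder x y).trans (by gcongr)

theorem norm_le (h : HolderBound n α K f) (x : E) : ‖f x‖ ≤ K := by
  simpa using h.bound 0 n.zero_le x

theorem nonneg (h : HolderBound n α K f) : 0 ≤ K :=
  (norm_nonneg _).trans (h.norm_le 0)

theorem add (h₁ : HolderBound n α K f₁) (h₂ : HolderBound n α L f₂) :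
    HolderBound n α (K + L) (f₁ + f₂) where
  contDiff := h₁.contDiff.add h₂.contDiff
  bound l hl x := by
    have hl' : (l : WithTop ℕ∞) ≤ n := by exact_mod_cast hl
    rw [iteratedFDeriv_add_apply (h₁.contDiff.of_le hl').contDiffAt
      (h₂.contDiff.of_le hl').contDiffAt]
    exact (norm_add_le _ _).trans (add_le_add (h₁.bound l hl x) (h₂.bound l hl x))
  holder x y := by
    rw [iteratedFDeriv_add_apply h₁.contDiff.contDiffAt h₂.contDiff.contDiffAt,
      iteratedFDeriv_add_apply h₁.contDiff.contDiffAt h₂.contDiff.contDiffAt,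
      add_sub_add_comm, add_mul]
    exact (norm_add_le _ _).trans (add_le_add (h₁.holder x y) (h₂.holder x y))

theorem neg (h : HolderBound n α K f) : HolderBound n α K (-f) where
  contDiff := h.contDiff.neg
  bound l hl x := by simpa [iteratedFDeriv_neg_apply] using h.bound l hl x
  holder x y := by
    rw [iteratedFDeriv_neg_apply, iteratedFDeriv_neg_apply, ← neg_sub', norm_neg]
    exact h.holder x y

theorem sub (h₁ : HolderBound n α K f₁) (h₂ : HolderBound n α L f₂) :
    HolderBound n α (K + L) (f₁ - f₂) := by
  simpa only [sub_eq_add_neg] using h₁.add h₂.neg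

theorem zero_iff : HolderBound 0 α K f ↔
    Continuous f ∧ (∀ x, ‖f x‖ ≤ K) ∧ ∀ x y, ‖f x - f y‖ ≤ K * ‖x - y‖ ^ α := by
  have key : ∀ x y, ‖iteratedFDeriv ℝ 0 f x - iteratedFDeriv ℝ 0 f y‖ = ‖f x - f y‖ :=
    fun x y => by
      rw [iteratedFDeriv_zero_eq_comp, comp_apply, comp_apply, ← map_sub,
        LinearIsometryEquiv.norm_map]
  constructor
  · exact fun h => ⟨h.contDiff.continuous, h.norm_le, fun x y => key x y ▸ h.holder x y⟩
  · rintro ⟨hc, hb, hh⟩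
    refine ⟨contDiff_zero.mpr hc, fun l hl x => ?_, fun x y => (key x y).trans_le (hh x y)⟩
    obtain rfl : l = 0 := by lia
    simpa using hb x

theorem succ_iff : HolderBound (n + 1) α K f ↔
    Differentiable ℝ f ∧ (∀ x, ‖f x‖ ≤ K) ∧ HolderBound n α K (fderiv ℝ f) := by
  have key : ∀ x y, ‖iteratedFDeriv ℝ (n + 1) f x - iteratedFDeriv ℝ (n + 1) f y‖ =
      ‖iteratedFDeriv ℝ n (fderiv ℝ f) x - iteratedFDeriv ℝ n (fderiv ℝ f) y‖ := fun x y => by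
    let I : (E [×n]→L[ℝ] (E →L[ℝ] F)) ≃ₗᵢ[ℝ] (E [×(n + 1)]→L[ℝ] F) :=
      (continuousMultilinearCurryRightEquiv' ℝ n E F).symm
    have hI : ∀ z, iteratedFDeriv ℝ (n + 1) f z = I (iteratedFDeriv ℝ n (fderiv ℝ f) z) :=
      fun z => by rw [iteratedFDeriv_succ_eq_comp_right, comp_apply]
    rw [hI, hI, ← I.map_sub, I.norm_map]
  have hcd : ContDiff ℝ ((n + 1 : ℕ) : WithTop ℕ∞) f ↔
      Differentiable ℝ f ∧ ContDiff ℝ n (fderiv ℝ f) := by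
    push_cast
    rw [contDiff_succ_iff_fderiv]
    simp
  constructor
  · intro h
    obtain ⟨hd, hc⟩ := hcd.mp h.contDiff
    refine ⟨hd, h.norm_le, hc, fun l hl x => ?_, fun x y => key x y ▸ h.holder x y⟩
    rw [norm_iteratedFDeriv_fderiv]
    exact h.bound _ (by lia) x
  · rintro ⟨hd, hb, h⟩
    refine ⟨hcd.mpr ⟨hd, h.contDiff⟩, fun l hl x => ?_,
      fun x y => (key x y).trans_le (h.holder x y)⟩
    cases l with
    | zero => simpa using hb x
    | succ l =>
      rw [← norm_iteratedFDeriv_fderiv]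
      exact h.bound l (by lia) x

theorem norm_sub_le (h : HolderBound (n + 1) α K f) (x y : E) :
    ‖f x - f y‖ ≤ K * ‖x - y‖ := by
  obtain ⟨hd, -, h'⟩ := succ_iff.mp h
  exact convex_univ.norm_image_sub_le_of_norm_fderiv_le (fun z _ => hd z)
    (fun z _ => h'.norm_le z) (mem_univ y) (mem_univ x)

theorem of_succ (hα : 0 < α) (hα1 : α ≤ 1) (h : HolderBound (n + 1) α K f) :
    HolderBound n α (2 * K) f := by
  induction n generalizing F with
  | zero =>
    have hK := h.nonneg
    exact zero_iff.mpr ⟨h.contDiff.continuous, fun x => (h.norm_le x).trans (by linarith),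
      norm_sub_le_rpow_of_lipschitz hα hα1 h.norm_le h.norm_sub_le⟩
  | succ n ih =>
    have hK := h.nonneg
    obtain ⟨hd, hb, h'⟩ := succ_iff.mp h
    exact succ_iff.mpr ⟨hd, fun x => (hb x).trans (by linarith), ih h'⟩

theorem const (c : F) : HolderBound n α ‖c‖ (fun _ : E => c) := by
  have h0 : HolderBound n α 0 (fun _ : E => (0 : F)) :=
    ⟨contDiff_const, fun l _ x => by simp, fun x y => by simp⟩
  cases n with
  | zero => exact zero_iff.mpr ⟨continuous_const, fun _ => le_rfl, fun x y => by
      simpa using by positivity⟩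
  | succ n => exact succ_iff.mpr ⟨differentiable_const c, fun _ => le_rfl, by
      simpa using (succ_iff.mp h0).2.2.mono (norm_nonneg c)⟩

/-- Leibniz rule: a bounded bilinear map acts boundedly on Hölder spaces. -/
theorem bilinear (hα : 0 < α) (hα1 : α ≤ 1) (B : F →L[ℝ] G →L[ℝ] H) {u : E → F} {v : E → G}
    (hu : HolderBound n α K u) (hv : HolderBound n α L v) :
    HolderBound n α (2 * 4 ^ n * ‖B‖ * K * L) (fun x => B (u x) (v x)) := by
  have hK := hu.nonneg
  have hL := hv.nonneg
  have hb : ∀ x, ‖B (u x) (v x)‖ ≤ ‖B‖ * K * L := fun x =>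
    (B.le_opNorm₂ _ _).trans (by gcongr; exacts [hu.norm_le x, hv.norm_le x])
  have hBKL : 0 ≤ ‖B‖ * K * L := by positivity
  induction n generalizing F G H K L with
  | zero =>
    refine zero_iff.mpr ⟨?_, fun x => (hb x).trans (by linarith), fun x y => ?_⟩
    · exact (B.continuous.comp hu.contDiff.continuous).clm_apply hv.contDiff.continuous
    · have h1 : B (u x) (v x) - B (u y) (v y) = B (u x) (v x - v y) + B (u x - u y) (v y) := by
        simp
      rw [h1]
      have h2 : ‖B (u x) (v x - v y)‖ ≤ ‖B‖ * K * (L * ‖x - y‖ ^ α) :=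
        (B.le_opNorm₂ _ _).trans (by
          gcongr; exacts [hu.norm_le x, (zero_iff.mp hv).2.2 x y])
      have h3 : ‖B (u x - u y) (v y)‖ ≤ ‖B‖ * (K * ‖x - y‖ ^ α) * L :=
        (B.le_opNorm₂ _ _).trans (by
          gcongr; exacts [(zero_iff.mp hu).2.2 x y, hv.norm_le y])
      refine (norm_add_le_of_le h2 h3).trans (le_of_eq (by ring))
  | succ n ih =>
    obtain ⟨hud, -, hu'⟩ := succ_iff.mp hu
    obtain ⟨hvd, -, hv'⟩ := succ_iff.mp hv
    have hder : ∀ x, HasFDerivAt (fun x => B (u x) (v x))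
        (B.precompR E (u x) (fderiv ℝ v x) + B.precompL E (fderiv ℝ u x) (v x)) x := fun x =>
      B.hasFDerivAt_of_bilinear (hud x).hasFDerivAt (hvd x).hasFDerivAt
    have hfd : fderiv ℝ (fun x => B (u x) (v x)) =
        (fun x => B.precompR E (u x) (fderiv ℝ v x)) +
          fun x => B.precompL E (fderiv ℝ u x) (v x) :=
      funext fun x => (hder x).fderiv
    have hp : (1 : ℝ) ≤ 4 ^ (n + 1) := one_le_pow₀ (by norm_num)
    refine succ_iff.mpr ⟨fun x => (hder x).differentiableAt,
      fun x => (hb x).trans (by nlinarith), ?_⟩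
    have h1 := ih (B.precompR E) (of_succ hα hα1 hu) hv' (by positivity) hL
      (fun x => (ContinuousLinearMap.le_opNorm₂ _ _ _).trans (by
        gcongr; exacts [(of_succ hα hα1 hu).norm_le x, hv'.norm_le x])) (by positivity)
    have h2 := ih (B.precompL E) hu' (of_succ hα hα1 hv) hK (by positivity)
      (fun x => (ContinuousLinearMap.le_opNorm₂ _ _ _).trans (by
        gcongr; exacts [hu'.norm_le x, (of_succ hα hα1 hv).norm_le x])) (by positivity)
    rw [hfd]
    refine (h1.add h2).mono ?_
    calc _ ≤ 2 * 4 ^ n * ‖B‖ * (2 * K) * L + 2 * 4 ^ n * ‖B‖ * K * (2 * L) := by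
          gcongr
          exacts [B.norm_precompR_le E, B.norm_precompL_le E]
      _ = _ := by ring

theorem clm_comp (hα : 0 < α) (hα1 : α ≤ 1) {u : E → G →L[ℝ] H} {v : E → F →L[ℝ] G}
    (hu : HolderBound n α K u) (hv : HolderBound n α L v) :
    HolderBound n α (2 * 4 ^ n * K * L) (fun x => (u x).comp (v x)) := by
  have hK := hu.nonneg
  have hL := hv.nonneg
  refine (bilinear hα hα1 (ContinuousLinearMap.compL ℝ F G H) hu hv).mono ?_
  have h := ContinuousLinearMap.norm_compL_le ℝ F G H
  calc _ ≤ 2 * 4 ^ n * 1 * K * L := by gcongr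
    _ = _ := by ring

end HolderBound

theorem norm_id_add_sub_rpow_le {E : Type*} [NormedAddCommGroup E] {α : ℝ} (hα : 0 < α)
    (hα1 : α ≤ 1) {L : ℝ} (hL : 0 ≤ L) {x y a b : E} (h : ‖a - b‖ ≤ L * ‖x - y‖) :
    ‖(x + a) - (y + b)‖ ^ α ≤ (1 + L) * ‖x - y‖ ^ α := by
  have h1 : ‖(x + a) - (y + b)‖ ≤ (1 + L) * ‖x - y‖ := by
    rw [add_sub_add_comm, add_mul, one_mul]
    exact norm_add_le_of_le le_rfl h
  calc ‖(x + a) - (y + b)‖ ^ α ≤ ((1 + L) * ‖x - y‖) ^ α := by gcongr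
    _ = (1 + L) ^ α * ‖x - y‖ ^ α := Real.mul_rpow (by linarith) (norm_nonneg _)
    _ ≤ _ := by
      gcongr
      simpa using Real.rpow_le_rpow_of_exponent_le (by linarith : 1 ≤ 1 + L) hα1

section Translation

universe u

variable {E : Type u} [NormedAddCommGroup E] [NormedSpace ℝ E] {α : ℝ}

theorem hasFDerivAt_comp_id_add {F : Type u} [NormedAddCommGroup F] [NormedSpace ℝ F]
    {g : E → F} {f : E → E} (hg : Differentiable ℝ g) (hf : Differentiable ℝ f) (x : E) :
    HasFDerivAt (fun x => g (x + f x))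
      ((fderiv ℝ g (x + f x)).comp (ContinuousLinearMap.id ℝ E + fderiv ℝ f x)) x :=
  HasFDerivAt.comp x (hg _).hasFDerivAt ((hasFDerivAt_id x).add (hf x).hasFDerivAt)

theorem HolderBound.id_add_fderiv {n : ℕ} {L : ℝ} {f : E → E}
    (hf : HolderBound n α L (fderiv ℝ f)) :
    HolderBound n α (1 + L) (fun x => ContinuousLinearMap.id ℝ E + fderiv ℝ f x) :=
  (((HolderBound.const (ContinuousLinearMap.id ℝ E)).mono
    ContinuousLinearMap.norm_id_le).add hf)

/-- Composition with `Id + f` is bounded on Hölder spaces, uniformly for bounded `f`. -/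
theorem HolderBound.exists_comp_id_add (hα : 0 < α) (hα1 : α ≤ 1) (n : ℕ) {L : ℝ} (hL : 0 ≤ L) :
    ∃ C : ℝ, 0 ≤ C ∧ ∀ (F : Type u) [NormedAddCommGroup F] [NormedSpace ℝ F] (g : E → F)
      (f : E → E) (K : ℝ), HolderBound n α K g → HolderBound n α L f →
      (∀ x y, ‖f x - f y‖ ≤ L * ‖x - y‖) →
      HolderBound n α (C * K) (fun x => g (x + f x)) := by
  induction n generalizing L with
  | zero =>
    refine ⟨1 + L, by positivity, fun F _ _ g f K hg hf hl => ?_⟩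
    have hK := hg.nonneg
    obtain ⟨hgc, hgb, hgh⟩ := zero_iff.mp hg
    refine zero_iff.mpr ⟨?_, fun x => (hgb _).trans (by nlinarith), fun x y => ?_⟩
    · exact hgc.comp (continuous_id.add hf.contDiff.continuous)
    · calc _ ≤ K * ‖(x + f x) - (y + f y)‖ ^ α := hgh _ _
        _ ≤ K * ((1 + L) * ‖x - y‖ ^ α) := by
          gcongr
          exact norm_id_add_sub_rpow_le hα hα1 hL (hl x y)
        _ = _ := by ring
  | succ n ih =>
    obtain ⟨C, hC, h⟩ := ih (L := 2 * L) (by positivity)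
    refine ⟨1 + 2 * 4 ^ n * C * (1 + L), by positivity, fun F _ _ g f K hg hf hl => ?_⟩
    have hK := hg.nonneg
    obtain ⟨hgd, hgb, hg'⟩ := succ_iff.mp hg
    obtain ⟨hfd, -, hf'⟩ := succ_iff.mp hf
    have hder := hasFDerivAt_comp_id_add hgd hfd
    have hrest : 0 ≤ 2 * 4 ^ n * C * (1 + L) * K := by positivity
    refine succ_iff.mpr ⟨fun x => (hder x).differentiableAt,
      fun x => (hgb _).trans (by linarith), ?_⟩
    have h1 := h _ (fderiv ℝ g) f K hg' (of_succ hα hα1 hf) fun x y =>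
      (hl x y).trans (by gcongr; linarith)
    rw [funext fun x => (hder x).fderiv]
    exact (clm_comp hα hα1 h1 (id_add_fderiv hf')).mono (by linarith)

theorem HolderBound.norm_sub_sub_sub_le {F : Type u} [NormedAddCommGroup F] [NormedSpace ℝ F]
    {g : E → F} {K M P : ℝ} (hg : HolderBound 1 α K g) {a b h k : E}
    (hh : ‖h‖ ≤ M)
    (hP : ∀ t ∈ Icc (0 : ℝ) 1, ‖(a + t • h) - (b + t • k)‖ ^ α ≤ P) :
    ‖(g (a + h) - g a) - (g (b + k) - g b)‖ ≤ K * P * M + K * ‖h - k‖ := by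
  obtain ⟨hgd, -, hg'⟩ := succ_iff.mp hg
  have hK := hg.nonneg
  have hline : ∀ (a h : E) (t : ℝ), HasDerivAt (fun t : ℝ => g (a + t • h))
      (fderiv ℝ g (a + t • h) h) t := fun a h t => by
    have h1 : HasDerivAt (fun t : ℝ => a + t • h) h t := by
      simpa using ((hasDerivAt_id t).smul_const h).const_add a
    exact (hgd _).hasFDerivAt.comp_hasDerivAt t h1
  have hbd : ∀ t ∈ Ico (0 : ℝ) 1, ‖fderiv ℝ g (a + t • h) h - fderiv ℝ g (b + t • k) k‖ ≤
      K * P * M + K * ‖h - k‖ := fun t ht => by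
    have h1 : fderiv ℝ g (a + t • h) h - fderiv ℝ g (b + t • k) k =
        (fderiv ℝ g (a + t • h) - fderiv ℝ g (b + t • k)) h + fderiv ℝ g (b + t • k) (h - k) := by
      simp
    rw [h1]
    refine norm_add_le_of_le ?_ ?_
    · refine (ContinuousLinearMap.le_opNorm _ _).trans ?_
      have h2 : ‖fderiv ℝ g (a + t • h) - fderiv ℝ g (b + t • k)‖ ≤ K * P :=
        ((zero_iff.mp hg').2.2 _ _).trans (by gcongr; exact hP t ⟨ht.1, ht.2.le⟩)
      exact mul_le_mul h2 hh (norm_nonneg _) ((norm_nonneg _).trans h2)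
    · exact (ContinuousLinearMap.le_opNorm _ _).trans (by gcongr; exact hg'.norm_le _)
  have := norm_image_sub_le_of_norm_deriv_le_segment_01'
    (f := fun t : ℝ => g (a + t • h) - g (b + t • k))
    (fun t _ => ((hline a h t).sub (hline b k t)).hasDerivWithinAt) hbd
  simp only [one_smul, zero_smul, add_zero] at this
  rwa [sub_sub_sub_comm]

/-- Left translation is Lipschitz on bounded sets of a Hölder space. -/
theorem HolderBound.exists_comp_id_add_sub (hα : 0 < α) (hα1 : α ≤ 1) (n : ℕ) {L : ℝ}
    (hL : 0 ≤ L) :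
    ∃ C : ℝ, 0 ≤ C ∧ ∀ (F : Type u) [NormedAddCommGroup F] [NormedSpace ℝ F] (g : E → F)
      (f₁ f₂ : E → E) (K M : ℝ), HolderBound (n + 1) α K g → HolderBound n α L f₁ →
      HolderBound n α L f₂ → (∀ x y, ‖f₁ x - f₁ y‖ ≤ L * ‖x - y‖) →
      (∀ x y, ‖f₂ x - f₂ y‖ ≤ L * ‖x - y‖) → HolderBound n α M (f₁ - f₂) →
      HolderBound n α (C * K * M) (fun x => g (x + f₁ x) - g (x + f₂ x)) := by
  have hsup : ∀ (n : ℕ) (F : Type u) [NormedAddCommGroup F] [NormedSpace ℝ F] (g : E → F)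
      (f₁ f₂ : E → E) (K M : ℝ), HolderBound (n + 1) α K g → HolderBound n α M (f₁ - f₂) →
      ∀ x, ‖g (x + f₁ x) - g (x + f₂ x)‖ ≤ K * M := fun n F _ _ g f₁ f₂ K M hg hM x => by
    have hK := hg.nonneg
    refine (hg.norm_sub_le _ _).trans ?_
    rw [add_sub_add_left_eq_sub]
    gcongr
    exact hM.norm_le x
  induction n generalizing L with
  | zero =>
    refine ⟨2 + L, by positivity, fun F _ _ g f₁ f₂ K M hg hf₁ hf₂ hl₁ hl₂ hM => ?_⟩
    have hK := hg.nonneg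
    have hM0 := hM.nonneg
    have hKM : 0 ≤ K * M := by positivity
    obtain ⟨-, hMb, hMh⟩ := zero_iff.mp hM
    have hgc := hg.contDiff.continuous
    refine zero_iff.mpr ⟨?_, fun x => (hsup 0 F g f₁ f₂ K M hg hM x).trans (by nlinarith),
      fun x y => ?_⟩
    · exact (hgc.comp (continuous_id.add hf₁.contDiff.continuous)).sub
        (hgc.comp (continuous_id.add hf₂.contDiff.continuous))
    · have h := hg.norm_sub_sub_sub_le (a := x + f₂ x) (b := y + f₂ y) (h := f₁ x - f₂ x)
        (k := f₁ y - f₂ y) (P := (1 + L) * ‖x - y‖ ^ α) (hMb x) fun t ht => by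
          rw [add_assoc, add_assoc]
          refine norm_id_add_sub_rpow_le hα hα1 hL ?_
          have h1 : f₂ x + t • (f₁ x - f₂ x) - (f₂ y + t • (f₁ y - f₂ y)) =
              t • (f₁ x - f₁ y) + (1 - t) • (f₂ x - f₂ y) := by module
          rw [h1]
          refine (norm_add_le _ _).trans ?_
          rw [norm_smul, norm_smul, Real.norm_of_nonneg ht.1,
            Real.norm_of_nonneg (sub_nonneg.mpr ht.2)]
          nlinarith [mul_le_mul_of_nonneg_left (hl₁ x y) ht.1,
            mul_le_mul_of_nonneg_left (hl₂ x y) (sub_nonneg.mpr ht.2)]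
      have e : ∀ z, z + f₂ z + (f₁ z - f₂ z) = z + f₁ z := fun z => by abel
      rw [e, e] at h
      refine h.trans ?_
      have h2 : K * ‖f₁ x - f₂ x - (f₁ y - f₂ y)‖ ≤ K * (M * ‖x - y‖ ^ α) := by
        gcongr
        exact hMh x y
      linarith
  | succ n ih =>
    obtain ⟨C, hC, h⟩ := ih (L := 2 * L) (by positivity)
    obtain ⟨D, hD, hcomp⟩ := exists_comp_id_add (E := E) hα hα1 n (L := 2 * L) (by positivity)
    refine ⟨1 + 2 * 4 ^ n * (2 * C) * (1 + L) + 2 * 4 ^ n * (2 * D), by positivity,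
      fun F _ _ g f₁ f₂ K M hg hf₁ hf₂ hl₁ hl₂ hM => ?_⟩
    have hK := hg.nonneg
    have hM0 := hM.nonneg
    obtain ⟨hgd, -, hg'⟩ := succ_iff.mp hg
    obtain ⟨hfd₁, -, hf₁'⟩ := succ_iff.mp hf₁
    obtain ⟨hfd₂, -, hf₂'⟩ := succ_iff.mp hf₂
    obtain ⟨-, -, hM'⟩ := succ_iff.mp hM
    have hder := fun x => (hasFDerivAt_comp_id_add hgd hfd₁ x).sub
      (hasFDerivAt_comp_id_add hgd hfd₂ x)
    have hl : L ≤ 2 * L := by linarith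
    have hl₁' : ∀ x y, ‖f₁ x - f₁ y‖ ≤ 2 * L * ‖x - y‖ := fun x y =>
      (hl₁ x y).trans (by gcongr)
    have hl₂' : ∀ x y, ‖f₂ x - f₂ y‖ ≤ 2 * L * ‖x - y‖ := fun x y =>
      (hl₂ x y).trans (by gcongr)
    have hA := clm_comp hα hα1 (h _ (fderiv ℝ g) f₁ f₂ K (2 * M) hg' (of_succ hα hα1 hf₁)
      (of_succ hα hα1 hf₂) hl₁' hl₂' (of_succ hα hα1 hM)) (id_add_fderiv hf₁')
    have hB := clm_comp hα hα1 (hcomp _ (fderiv ℝ g) f₂ (2 * K) (of_succ hα hα1 hg')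
      (of_succ hα hα1 hf₂) hl₂') hM'
    have h1 : 0 ≤ 2 * 4 ^ n * (2 * C) * (1 + L) * K * M := by positivity
    have h2 : 0 ≤ 2 * 4 ^ n * (2 * D) * K * M := by positivity
    have h3 : 0 ≤ K * M := by positivity
    refine succ_iff.mpr ⟨fun x => (hder x).differentiableAt,
      fun x => (hsup (n + 1) F g f₁ f₂ K M hg hM x).trans (by linarith), ?_⟩
    have e : fderiv ℝ (fun x => g (x + f₁ x) - g (x + f₂ x)) =
        (fun x => (fderiv ℝ g (x + f₁ x) - fderiv ℝ g (x + f₂ x)).comp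
          (ContinuousLinearMap.id ℝ E + fderiv ℝ f₁ x)) +
        fun x => (fderiv ℝ g (x + f₂ x)).comp (fderiv ℝ (f₁ - f₂) x) := by
      funext x
      refine (hder x).fderiv.trans ?_
      rw [Pi.add_apply, fderiv_sub (hfd₁ x) (hfd₂ x)]
      ext v
      simp
      abel
    rw [e]
    exact (hA.add hB).mono (by linarith)

end Translation

/-- local Lipschitz continuity of left translation, `α = β` case:
for `g ∈ C^{m+1,α}_b(ℝ^d,ℝ^d)`, the left translation `f ↦ g∘(Id+f)` on
`C^{m,α}_b(ℝ^d,ℝ^d)` is locally Lipschitz: every `f₀` has a ball around it on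
which the map is Lipschitz. -/
theorem stmt5 (d m : ℕ) (hm : 1 ≤ m) (α : ℝ) (hα : 0 < α) (hα1 : α ≤ 1)
    (g : Euc d → Euc d) (hg : MemCb (m + 1) α g) :
    ∀ f₀ : Euc d → Euc d, MemCb m α f₀ →
      ∃ δ > (0 : ℝ), ∃ C : ℝ,
        ∀ f₁ f₂ : Euc d → Euc d, MemCb m α f₁ → MemCb m α f₂ →
          hnorm m α (f₁ - f₀) < δ → hnorm m α (f₂ - f₀) < δ →
          hnorm m α (fun x => g (x + f₁ x) - g (x + f₂ x)) ≤ C * hnorm m α (f₁ - f₂) := by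
  intro f₀ hf₀
  obtain ⟨n, rfl⟩ : ∃ n, m = n + 1 := ⟨m - 1, by lia⟩
  have h₀ := hf₀.holderBound hα
  have hg' := hg.holderBound hα
  have hL : 0 ≤ hnorm (n + 1) α f₀ + 1 := by linarith [h₀.nonneg]
  obtain ⟨C, -, hC⟩ := HolderBound.exists_comp_id_add_sub (E := Euc d) hα hα1 (n + 1) hL
  refine ⟨1, one_pos, C * hnorm (n + 1 + 1) α g, fun f₁ f₂ hf₁ hf₂ h₁ h₂ => ?_⟩
  have hnear : ∀ f : Euc d → Euc d, MemCb (n + 1) α f → hnorm (n + 1) α (f - f₀) < 1 →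
      HolderBound (n + 1) α (hnorm (n + 1) α f₀ + 1) f := fun f hf h => by
    have hsub := ((hf.holderBound hα).sub h₀).memCb.holderBound hα
    simpa using h₀.add (hsub.mono h.le)
  have b₁ := hnear f₁ hf₁ h₁
  have b₂ := hnear f₂ hf₂ h₂
  exact (hC _ g f₁ f₂ _ _ hg' b₁ b₂ b₁.norm_sub_le b₂.norm_sub_le
    ((b₁.sub b₂).memCb.holderBound hα)).hnorm_le
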